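/- Let p be an odd prime, f : ℤ_p → ℤ_p continuous, λ, u ∈ ℚ_p with ‖λ‖_p > 1 and ‖u‖_p < ‖λ‖_p, and s ∈ ℤ_p. Then all fermionic integrals E_n^f(u) := ∫_{ℤ_p} (u+f(a))^n dμ_{−1}(a) exist, the series Σ_{n=0}^∞ C(1−s,n)·E_n^f(u)·λ^{−n} converges, and ζ_{p,E}^f(s,λ+u) = ⟨λ⟩^{1−s}·Σ_{n=0}^∞ C(1−s,n)·E_n^f(u)·λ^{−n}. -/

import Mathlib

open Filter Topology

namespace PZeta

variable (p : ℕ) [Fact p.Prime]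

/-- The `N`-th partial sum defining the fermionic integral
`∫_{ℤ_p} g dμ₋₁ = lim_N Σ_{a=0}^{p^N-1} (-1)^a g(a)`. -/
noncomputable def fermSum (g : ℤ_[p] → ℚ_[p]) (N : ℕ) : ℚ_[p] :=
  ∑ a ∈ Finset.range (p ^ N), (-1 : ℚ_[p]) ^ a * g (a : ℤ_[p])

/-- The `N`-th partial sum defining the Volkenborn integral
`∫_{ℤ_p} g da = lim_N p^{-N} Σ_{a=0}^{p^N-1} g(a)`. -/
noncomputable def volkSum (g : ℤ_[p] → ℚ_[p]) (N : ℕ) : ℚ_[p] :=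
  ((p : ℚ_[p]) ^ N)⁻¹ * ∑ a ∈ Finset.range (p ^ N), g (a : ℤ_[p])

/-- The unit part `x·p^{-v_p(x)}` of a nonzero `p`-adic number. -/
noncomputable def unitPart (x : ℚ_[p]) : ℚ_[p] := x * (p : ℚ_[p]) ^ (-x.valuation)

/-- The Teichmüller representative of a `p`-adic unit, `lim_n x^{p^n}`. -/
noncomputable def teich (x : ℚ_[p]) : ℚ_[p] :=
  limUnder atTop fun n : ℕ => x ^ p ^ n

/-- The projection `⟨x⟩ ∈ 1 + pℤ_p`, via `x = p^{v_p(x)}·ζ·⟨x⟩`. -/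
noncomputable def angle (x : ℚ_[p]) : ℚ_[p] := unitPart p x / teich p (unitPart p x)

/-- `ω_v(x) := x / ⟨x⟩ = p^{v_p(x)}·ζ`. -/
noncomputable def omegaV (x : ℚ_[p]) : ℚ_[p] := x / angle p x

/-- The generalized binomial coefficient `C(t,n) = t(t-1)⋯(t-n+1)/n!`. -/
noncomputable def gbinom (t : ℚ_[p]) (n : ℕ) : ℚ_[p] :=
  (∏ i ∈ Finset.range n, (t - (i : ℚ_[p]))) / (n.factorial : ℚ_[p])

/-- The power `y^t` defined by the binomial series `Σ_n C(t,n)(y-1)^n`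
(used for `y ∈ 1 + pℤ_p` and `t ∈ ℤ_p`). -/
noncomputable def bpow (y t : ℚ_[p]) : ℚ_[p] := ∑' n : ℕ, gbinom p t n * (y - 1) ^ n

/-- The Iwasawa `p`-adic logarithm: `log_p x = Σ_{n≥1} (-1)^{n+1}(⟨x⟩-1)^n/n`
(one has `log_p p = 0` and `log_p ζ = 0` for roots of unity of order prime to `p`). -/
noncomputable def padicLog (x : ℚ_[p]) : ℚ_[p] :=
  ∑' n : ℕ, (-1 : ℚ_[p]) ^ n * (angle p x - 1) ^ (n + 1) / ((n : ℚ_[p]) + 1)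

/-- The power `y^t` defined by the exponential series `Σ_n (t·log_p y)^n/n!`
(used for `y ∈ 1 + pℤ_p` and `‖t‖ < p^{(p-2)/(p-1)}`). -/
noncomputable def epow (y t : ℚ_[p]) : ℚ_[p] :=
  ∑' n : ℕ, (t * padicLog p y) ^ n / (n.factorial : ℚ_[p])

/-- `f : ℤ_p → ℤ_p` is everywhere analytic with integral coefficients:
`f(x) = Σ_k c_k x^k` with `‖c_k‖ ≤ 1`, `c_k → 0`. -/
def EverywhereAnalytic (f : ℤ_[p] → ℤ_[p]) : Prop :=
  ∃ c : ℕ → ℚ_[p], (∀ k, ‖c k‖ ≤ 1) ∧ Tendsto c atTop (𝓝 0) ∧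
    ∀ x : ℤ_[p], (f x : ℚ_[p]) = ∑' k : ℕ, c k * (x : ℚ_[p]) ^ k

/-- The `p`-adic Hurwitz-type Euler zeta function w.r.t. `f`:
`ζ_{p,E}^f(s,λ) = ∫_{ℤ_p} ⟨λ+f(a)⟩^{1-s} dμ₋₁(a)`. -/
noncomputable def zetaE (f : ℤ_[p] → ℤ_[p]) (s : ℤ_[p]) (lam : ℚ_[p]) : ℚ_[p] :=
  limUnder atTop
    (fermSum p fun a => bpow p (angle p (lam + (f a : ℚ_[p]))) (1 - (s : ℚ_[p])))

/-- The `p`-adic Hurwitz zeta function w.r.t. `f`: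
`ζ_p^f(s,λ) = (s-1)⁻¹ ∫_{ℤ_p} ⟨λ+f(a)⟩^{1-s} da`. -/
noncomputable def zetaH (f : ℤ_[p] → ℤ_[p]) (s : ℤ_[p]) (lam : ℚ_[p]) : ℚ_[p] :=
  ((s : ℚ_[p]) - 1)⁻¹ *
    limUnder atTop
      (volkSum p fun a => bpow p (angle p (lam + (f a : ℚ_[p]))) (1 - (s : ℚ_[p])))

end PZeta

open PZeta

namespace PZeta

variable (p : ℕ) [Fact p.Prime]

lemma sum_range_mul_eq {M : Type*} [AddCommMonoid M] (F : ℕ → M) (m k : ℕ) :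
    ∑ a ∈ Finset.range (m * k), F a =
      ∑ c ∈ Finset.range k, ∑ b ∈ Finset.range m, F (m * c + b) := by
  induction k with
  | zero => simp
  | succ k ih => rw [Nat.mul_succ, Finset.sum_range_add, ih, Finset.sum_range_succ]

lemma norm_fermSum_le {g : ℤ_[p] → ℚ_[p]} {C : ℝ} (hC : 0 ≤ C) (hg : ∀ x, ‖g x‖ ≤ C) (N : ℕ) :
    ‖fermSum p g N‖ ≤ C := by
  refine IsUltrametricDist.norm_sum_le_of_forall_le_of_nonneg hC fun a _ => ?_
  simpa using hg a

lemma fermSum_succ_sub (hp : Odd p) (g : ℤ_[p] → ℚ_[p]) (N : ℕ) :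
    fermSum p g (N + 1) - fermSum p g N =
      ∑ c ∈ Finset.range p, ∑ b ∈ Finset.range (p ^ N), (-1 : ℚ_[p]) ^ (c + b) *
        (g ((b : ℤ_[p]) + (p : ℤ_[p]) ^ N * c) - g b) := by
  have hone : ∑ c ∈ Finset.range p, (-1 : ℚ_[p]) ^ c = 1 := by
    rw [neg_one_geom_sum, if_neg (Nat.not_even_iff_odd.2 hp)]
  have hN : fermSum p g N = ∑ c ∈ Finset.range p, (-1 : ℚ_[p]) ^ c * fermSum p g N := by
    rw [← Finset.sum_mul, hone, one_mul]
  rw [hN, fermSum, pow_succ, sum_range_mul_eq, ← Finset.sum_sub_distrib]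
  refine Finset.sum_congr rfl fun c _ => ?_
  rw [fermSum, Finset.mul_sum, ← Finset.sum_sub_distrib]
  refine Finset.sum_congr rfl fun b _ => ?_
  rw [pow_add, pow_mul, (hp.pow (n := N)).neg_one_pow, pow_add]
  push_cast
  rw [add_comm (b : ℤ_[p])]
  ring

lemma exists_tendsto_fermSum (hp : Odd p) {g : ℤ_[p] → ℚ_[p]} (hg : Continuous g) :
    ∃ L, Tendsto (fermSum p g) atTop (𝓝 L) := by
  refine cauchySeq_tendsto_of_complete
    (NonarchimedeanAddGroup.cauchySeq_of_tendsto_sub_nhds_zero ?_)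
  have hu : UniformContinuous g := CompactSpace.uniformContinuous_of_continuous hg
  rw [Metric.tendsto_atTop]
  intro ε hε
  obtain ⟨δ, hδ, h⟩ := Metric.uniformContinuous_iff.1 hu (ε / 2) (half_pos hε)
  obtain ⟨M, hM⟩ := PadicInt.exists_pow_neg_lt p hδ
  refine ⟨M, fun N hN => ?_⟩
  rw [dist_zero_right, fermSum_succ_sub p hp]
  refine lt_of_le_of_lt ?_ (half_lt_self hε)
  refine IsUltrametricDist.norm_sum_le_of_forall_le_of_nonneg (half_pos hε).le fun c _ => ?_
  refine IsUltrametricDist.norm_sum_le_of_forall_le_of_nonneg (half_pos hε).le fun b _ => ?_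
  rw [norm_mul, norm_pow, norm_neg, norm_one, one_pow, one_mul, ← dist_eq_norm]
  refine (h ?_).le
  rw [dist_eq_norm, add_sub_cancel_left]
  refine lt_of_le_of_lt ?_ hM
  rw [norm_mul, PadicInt.norm_p_pow]
  have h1 : (1 : ℝ) ≤ p := by exact_mod_cast (Fact.out : p.Prime).one_le
  calc _ ≤ (p : ℝ) ^ (-(N : ℤ)) * 1 := by gcongr; exact PadicInt.norm_le_one _
    _ ≤ _ := by rw [mul_one]; exact zpow_le_zpow_right₀ h1 (by omega)

lemma gbinom_eq_choose (t : ℤ_[p]) (n : ℕ) :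
    gbinom p t n = ((Ring.choose t n : ℤ_[p]) : ℚ_[p]) := by
  have h := Ring.descPochhammer_eq_factorial_smul_choose t n
  rw [← Polynomial.aeval_eq_smeval, Polynomial.aeval_def, Polynomial.eval₂_eq_eval_map,
    descPochhammer_map, descPochhammer_eval_eq_prod_range, nsmul_eq_mul] at h
  rw [gbinom, div_eq_iff (by exact_mod_cast n.factorial_ne_zero), mul_comm]
  have h' := congrArg PadicInt.Coe.ringHom h
  simp only [map_prod, map_sub, map_mul, map_natCast] at h'
  exact h'

lemma norm_gbinom_le_one (t : ℤ_[p]) (n : ℕ) : ‖gbinom p t n‖ ≤ 1 := by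
  rw [gbinom_eq_choose]
  exact PadicInt.norm_le_one _

lemma bpow_natCast (y : ℚ_[p]) (n : ℕ) : bpow p y n = y ^ n := by
  have h (k : ℕ) : gbinom p (n : ℚ_[p]) k = n.choose k := by
    have := gbinom_eq_choose p (n : ℤ_[p]) k
    rw [Ring.choose_natCast] at this
    simpa using this
  rw [bpow, tsum_eq_sum (s := Finset.range (n + 1))]
  · conv_rhs => rw [← sub_add_cancel y 1, add_pow]
    refine Finset.sum_congr rfl fun k _ => ?_
    rw [h, one_pow]
    ring
  · intro k hk
    rw [h, Nat.choose_eq_zero_of_lt (by simpa using hk)]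
    simp

lemma continuous_bpow {y : ℚ_[p]} (hy : ‖y - 1‖ < 1) :
    Continuous fun t : ℤ_[p] => bpow p y t := by
  simp only [bpow, gbinom_eq_choose]
  refine continuous_tsum (u := fun n => ‖y - 1‖ ^ n) (fun n => ?_)
    (summable_geometric_of_lt_one (norm_nonneg _) hy) fun n t => ?_
  · exact (continuous_subtype_val.comp (PadicInt.continuous_choose n)).mul continuous_const
  · rw [norm_mul, norm_pow]
    exact mul_le_of_le_one_left (by positivity) (PadicInt.norm_le_one _)

lemma norm_mul_sub_one_lt {x y : ℚ_[p]} (hx : ‖x - 1‖ < 1) (hy : ‖y - 1‖ < 1) :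
    ‖x * y - 1‖ < 1 := by
  have : x * y - 1 = (x - 1) * (y - 1) + ((x - 1) + (y - 1)) := by ring
  rw [this]
  refine (IsUltrametricDist.norm_add_le_max _ _).trans_lt (max_lt ?_ ?_)
  · rw [norm_mul]
    exact mul_lt_one_of_nonneg_of_lt_one_left (norm_nonneg _) hx hy.le
  · exact (IsUltrametricDist.norm_add_le_max _ _).trans_lt (max_lt hx hy)

lemma bpow_mul {x y : ℚ_[p]} (hx : ‖x - 1‖ < 1) (hy : ‖y - 1‖ < 1) (t : ℤ_[p]) :
    bpow p (x * y) t = bpow p x t * bpow p y t := by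
  refine congrFun (PadicInt.denseRange_natCast.equalizer
    (continuous_bpow p (norm_mul_sub_one_lt p hx hy))
    ((continuous_bpow p hx).mul (continuous_bpow p hy)) (funext fun n => ?_)) t
  simp [bpow_natCast, mul_pow]

lemma tendsto_pow_pow_sub_of_dvd {a b : ℤ_[p]} (h : (p : ℤ_[p]) ∣ a - b) :
    Tendsto (fun n : ℕ => (a : ℚ_[p]) ^ p ^ n - (b : ℚ_[p]) ^ p ^ n) atTop (𝓝 0) := by
  have hp1 : (1 : ℝ) < p := by exact_mod_cast (Fact.out : p.Prime).one_lt
  refine squeeze_zero_norm (a := fun n : ℕ => ((p : ℝ)⁻¹) ^ (n + 1)) (fun n => ?_)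
    ((tendsto_pow_atTop_nhds_zero_of_lt_one (by positivity)
      (inv_lt_one_of_one_lt₀ hp1)).comp (tendsto_add_atTop_nat 1))
  obtain ⟨c, hc⟩ := dvd_sub_pow_of_dvd_sub h n
  have hc' := congrArg (fun z : ℤ_[p] => ‖z‖) hc
  simp only [norm_mul, norm_pow, PadicInt.norm_p] at hc'
  have : ‖(a : ℚ_[p]) ^ p ^ n - (b : ℚ_[p]) ^ p ^ n‖ = ‖a ^ p ^ n - b ^ p ^ n‖ := by
    rw [PadicInt.norm_def]; push_cast; rfl
  rw [this, hc']
  exact mul_le_of_le_one_right (by positivity) (PadicInt.norm_le_one _)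

lemma dvd_pow_sub_self (a : ℤ_[p]) (n : ℕ) : (p : ℤ_[p]) ∣ a ^ p ^ n - a := by
  rw [← PadicInt.norm_lt_one_iff_dvd, ← PadicInt.mem_nonunits, ← IsLocalRing.mem_maximalIdeal,
    ← PadicInt.ker_toZMod, RingHom.mem_ker, map_sub, map_pow, ZMod.pow_card_pow, sub_self]

lemma tendsto_teich {x : ℚ_[p]} (hx : ‖x‖ ≤ 1) :
    Tendsto (fun n : ℕ => x ^ p ^ n) atTop (𝓝 (teich p x)) := by
  obtain ⟨x, rfl⟩ : ∃ z : ℤ_[p], (z : ℚ_[p]) = x := ⟨⟨x, hx⟩, rfl⟩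
  refine tendsto_nhds_limUnder (cauchySeq_tendsto_of_complete
    (NonarchimedeanAddGroup.cauchySeq_of_tendsto_sub_nhds_zero ?_))
  have := tendsto_pow_pow_sub_of_dvd p (a := x ^ p) (b := x) (by simpa using dvd_pow_sub_self p x 1)
  refine this.congr fun n => ?_
  push_cast
  rw [← pow_mul, ← pow_succ']

lemma norm_sub_teich_lt {x : ℚ_[p]} (hx : ‖x‖ ≤ 1) : ‖x - teich p x‖ < 1 := by
  have hp1 : (1 : ℝ) < p := by exact_mod_cast (Fact.out : p.Prime).one_lt
  refine lt_of_le_of_lt ?_ (inv_lt_one_of_one_lt₀ hp1)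
  refine le_of_tendsto ((tendsto_const_nhds (x := x)).sub (tendsto_teich p hx)).norm
    (Eventually.of_forall fun n => ?_)
  obtain ⟨x, rfl⟩ : ∃ z : ℤ_[p], (z : ℚ_[p]) = x := ⟨⟨x, hx⟩, rfl⟩
  obtain ⟨c, hc⟩ := dvd_pow_sub_self p x n
  have : ((x : ℚ_[p]) - (x : ℚ_[p]) ^ p ^ n) = -((p : ℚ_[p]) * c) := by
    have h := congrArg (fun z : ℤ_[p] => (z : ℚ_[p])) hc
    push_cast at h
    rw [← h]
    ring
  rw [this, norm_neg, norm_mul, Padic.norm_p]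
  exact mul_le_of_le_one_right (by positivity) (PadicInt.norm_le_one _)

lemma norm_eq_one_of_norm_sub_lt {x y : ℚ_[p]} (hx : ‖x‖ = 1) (h : ‖y - x‖ < 1) : ‖y‖ = 1 := by
  rw [sub_eq_add_neg] at h
  rw [IsUltrametricDist.norm_eq_of_add_norm_lt_max (h.trans_le ?_), norm_neg, hx]
  rw [norm_neg, hx]
  exact le_max_right _ _

lemma norm_teich {x : ℚ_[p]} (hx : ‖x‖ = 1) : ‖teich p x‖ = 1 := by
  have h := norm_sub_teich_lt p hx.le
  rw [norm_sub_rev] at h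
  exact norm_eq_one_of_norm_sub_lt p hx h

lemma teich_mul_of_norm_sub_one_lt {x y : ℚ_[p]} (hx : ‖x‖ ≤ 1) (hy : ‖y - 1‖ < 1) :
    teich p (x * y) = teich p x := by
  have hy1 : ‖y‖ ≤ 1 := (norm_eq_one_of_norm_sub_lt p norm_one hy).le
  have h1 : Tendsto (fun n : ℕ => y ^ p ^ n) atTop (𝓝 1) := by
    obtain ⟨y, rfl⟩ : ∃ z : ℤ_[p], (z : ℚ_[p]) = y := ⟨⟨y, hy1⟩, rfl⟩
    have hd : (p : ℤ_[p]) ∣ y - 1 := by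
      rw [← PadicInt.norm_lt_one_iff_dvd, PadicInt.norm_def]
      simpa using hy
    simpa using (tendsto_pow_pow_sub_of_dvd p hd).add_const 1
  refine Tendsto.limUnder_eq ?_
  simpa [mul_pow] using (tendsto_teich p hx).mul h1

lemma norm_unitPart {x : ℚ_[p]} (hx : x ≠ 0) : ‖unitPart p x‖ = 1 := by
  have hp0 : (p : ℝ) ≠ 0 := by exact_mod_cast (Fact.out : p.Prime).ne_zero
  rw [unitPart, norm_mul, Padic.norm_p_zpow, Padic.norm_eq_zpow_neg_valuation hx, ← zpow_add₀ hp0]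
  simp

lemma norm_angle_sub_one_lt {x : ℚ_[p]} (hx : x ≠ 0) : ‖angle p x - 1‖ < 1 := by
  have h1 := norm_unitPart p hx
  have h2 := norm_teich p h1
  have h0 : teich p (unitPart p x) ≠ 0 := by
    rw [← norm_ne_zero_iff, h2]; exact one_ne_zero
  rw [angle, div_sub_one h0, norm_div, h2, div_one]
  exact norm_sub_teich_lt p h1.le

lemma angle_mul_of_norm_sub_one_lt {x y : ℚ_[p]} (hx : x ≠ 0) (hy : ‖y - 1‖ < 1) :
    angle p (x * y) = angle p x * y := by
  have hp1 : (1 : ℝ) < p := by exact_mod_cast (Fact.out : p.Prime).one_lt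
  have hny : ‖y‖ = 1 := norm_eq_one_of_norm_sub_lt p norm_one hy
  have hy0 : y ≠ 0 := by rw [← norm_ne_zero_iff, hny]; exact one_ne_zero
  have hv : y.valuation = 0 := by
    rw [Padic.norm_eq_zpow_neg_valuation hy0, zpow_eq_one_iff_right₀ (by positivity) hp1.ne'] at hny
    simpa using hny
  have hu : unitPart p (x * y) = unitPart p x * y := by
    rw [unitPart, unitPart, Padic.valuation_mul hx hy0, hv, add_zero]
    ring
  rw [angle, angle, hu, teich_mul_of_norm_sub_one_lt p (norm_unitPart p hx).le hy]
  ring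

lemma bpow_angle_add {lam x : ℚ_[p]} (hx : ‖x‖ < ‖lam‖) (t : ℤ_[p]) :
    bpow p (angle p (lam + x)) t =
      bpow p (angle p lam) t * ∑' n : ℕ, gbinom p t n * x ^ n / lam ^ n := by
  have hpos : 0 < ‖lam‖ := (norm_nonneg x).trans_lt hx
  have h0 : lam ≠ 0 := norm_pos_iff.1 hpos
  have hy : ‖(1 + x / lam) - 1‖ < 1 := by
    rwa [add_sub_cancel_left, norm_div, div_lt_one hpos]
  rw [show lam + x = lam * (1 + x / lam) by field_simp, angle_mul_of_norm_sub_one_lt p h0 hy,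
    bpow_mul p (norm_angle_sub_one_lt p h0) hy, bpow.eq_def p (1 + x / lam)]
  simp only [add_sub_cancel_left, div_pow, mul_div_assoc]

lemma fermSum_tsum {g : ℕ → ℤ_[p] → ℚ_[p]} (hg : ∀ a, Summable fun n => g n a) (N : ℕ) :
    fermSum p (fun a => ∑' n, g n a) N = ∑' n, fermSum p (g n) N := by
  simp only [fermSum]
  rw [Summable.tsum_finsetSum fun (a : ℕ) _ => (hg a).mul_left ((-1) ^ a)]
  simp only [tsum_mul_left]

lemma fermSum_const_mul (c : ℚ_[p]) (g : ℤ_[p] → ℚ_[p]) (N : ℕ) :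
    fermSum p (fun a => c * g a) N = c * fermSum p g N := by
  simp only [fermSum, Finset.mul_sum]
  exact Finset.sum_congr rfl fun a _ => by ring

lemma tendsto_fermSum_tsum {g : ℕ → ℤ_[p] → ℚ_[p]} {L : ℕ → ℚ_[p]} {r : ℝ} (hr0 : 0 ≤ r)
    (hr1 : r < 1) (hg : ∀ n a, ‖g n a‖ ≤ r ^ n)
    (hL : ∀ n, Tendsto (fermSum p (g n)) atTop (𝓝 (L n))) :
    Summable L ∧ Tendsto (fermSum p fun a => ∑' n, g n a) atTop (𝓝 (∑' n, L n)) := by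
  have hs := summable_geometric_of_lt_one hr0 hr1
  have hb (n N : ℕ) : ‖fermSum p (g n) N‖ ≤ r ^ n := norm_fermSum_le p (pow_nonneg hr0 n) (hg n) N
  refine ⟨Summable.of_norm_bounded hs fun n =>
    le_of_tendsto (hL n).norm (Eventually.of_forall (hb n)), ?_⟩
  have := tendsto_tsum_of_dominated_convergence (f := fun N n => fermSum p (g n) N) hs hL
    (Eventually.of_forall fun N n => hb n N)
  refine this.congr fun N => ?_
  rw [fermSum_tsum p fun a => Summable.of_norm_bounded hs fun n => hg n a]

end PZeta

/-- shifted power series expansion of the `p`-adic Hurwitz-type Euler zeta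
function: for `‖λ‖ > 1`, `‖u‖ < ‖λ‖`, all `E_n^f(u) = ∫_{ℤ_p} (u+f(a))^n dμ₋₁(a)` exist,
`Σ_n C(1-s,n) E_n^f(u) λ^{-n}` converges, and
`ζ_{p,E}^f(s,λ+u) = ⟨λ⟩^{1-s} Σ_n C(1-s,n) E_n^f(u) λ^{-n}`. -/
theorem zetaE_power_series_shifted (p : ℕ) [Fact p.Prime] (hp : Odd p)
    (f : ℤ_[p] → ℤ_[p]) (hf : Continuous f)
    (lam u : ℚ_[p]) (hlam : 1 < ‖lam‖) (hu : ‖u‖ < ‖lam‖) (s : ℤ_[p]) :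
    ∃ (E : ℕ → ℚ_[p]) (I : ℚ_[p]),
      (∀ n : ℕ, Filter.Tendsto (fermSum p fun a => (u + (f a : ℚ_[p])) ^ n)
        Filter.atTop (nhds (E n))) ∧
      Filter.Tendsto
        (fermSum p fun a => bpow p (angle p (lam + u + (f a : ℚ_[p]))) (1 - (s : ℚ_[p])))
        Filter.atTop (nhds I) ∧
      Summable (fun n : ℕ => gbinom p (1 - (s : ℚ_[p])) n * E n / lam ^ n) ∧
      I = bpow p (angle p lam) (1 - (s : ℚ_[p])) *
            ∑' n : ℕ, gbinom p (1 - (s : ℚ_[p])) n * E n / lam ^ n := by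
  have hpos : 0 < ‖lam‖ := one_pos.trans hlam
  have hE (n : ℕ) := exists_tendsto_fermSum p hp (g := fun a => (u + (f a : ℚ_[p])) ^ n)
    ((continuous_const.add (continuous_subtype_val.comp hf)).pow n)
  choose E hE using hE
  have ht : (1 : ℚ_[p]) - (s : ℚ_[p]) = ((1 - s : ℤ_[p]) : ℚ_[p]) := by push_cast; rfl
  rw [ht]
  have hx (a : ℤ_[p]) : ‖u + (f a : ℚ_[p])‖ ≤ max ‖u‖ 1 :=
    (IsUltrametricDist.norm_add_le_max _ _).trans (max_le_max le_rfl (PadicInt.norm_le_one _))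
  have hmax : max ‖u‖ 1 < ‖lam‖ := max_lt hu hlam
  obtain ⟨hsum, htends⟩ := tendsto_fermSum_tsum p (r := max ‖u‖ 1 / ‖lam‖)
    (g := fun n a => gbinom p ((1 - s : ℤ_[p]) : ℚ_[p]) n * (u + (f a : ℚ_[p])) ^ n / lam ^ n)
    (L := fun n => gbinom p ((1 - s : ℤ_[p]) : ℚ_[p]) n * E n / lam ^ n)
    (by positivity) ((div_lt_one hpos).2 hmax)
    (fun n a => by
      rw [norm_div, norm_mul, norm_pow, norm_pow, div_pow]
      gcongr
      exact (mul_le_of_le_one_left (by positivity) (norm_gbinom_le_one p _ n)).trans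
        (pow_le_pow_left₀ (norm_nonneg _) (hx a) n))
    (fun n => by
      simp only [mul_div_right_comm]
      exact ((hE n).const_mul _).congr fun N => (fermSum_const_mul p _ _ N).symm)
  refine ⟨E, _, hE, ?_, hsum, rfl⟩
  refine (htends.const_mul _).congr fun N => ?_
  rw [← fermSum_const_mul]
  simp only [add_assoc, bpow_angle_add p ((hx _).trans_lt hmax)]
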